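/- Let Γ = (G, I, O, λ) be a labelled open graph with input u ∈ I, and let Γ' = (G', I', O, λ') be its input extension about u: G' is obtained from G by adding a fresh vertex u' adjacent only to u, I' := (I ∪ {u'}) ∖ {u}, and λ' := λ on V∖O together with λ'(u') := XY. If Γ has a Pauli flow, then so does Γ'. -/

import Mathlib

open scoped symmDiff

inductive MeasLabel : Type
  | XY | XZ | YZ | X | Y | Z
deriving DecidableEq

/-- A labelled open graph: a finite simple graph with input and output sets and a
measurement labelling (only its values on non-outputs are ever used). -/
structure LOG (V : Type) [Fintype V] where
  G : SimpleGraph V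
  I : Set V
  O : Set V
  lam : V → MeasLabel

namespace LOG

variable {V : Type} [Fintype V]

/-- The odd neighbourhood of `A`: vertices with an odd number of neighbours in `A`. -/
def odd (G : SimpleGraph V) (A : Set V) : Set V :=
  {w | Odd ((G.neighborSet w ∩ A).ncard)}

/-- `v` is a measured (non-output) vertex whose label lies in `s`.  (The labelling of a
labelled open graph is only defined on non-outputs.) -/
def labIn (Γ : LOG V) (v : V) (s : Set MeasLabel) : Prop :=
  v ∉ Γ.O ∧ Γ.lam v ∈ s

/-- The Pauli flow conditions for a map `p` and a strict partial order `prec` (`≺`). -/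
structure IsPauliFlow (Γ : LOG V) (p : V → Set V) (prec : V → V → Prop) : Prop where
  irrefl : ∀ a, ¬ prec a a
  trans : ∀ a b c, prec a b → prec b c → prec a c
  psub : ∀ u, u ∉ Γ.O → ∀ v ∈ p u, v ∉ Γ.I
  pf1 : ∀ u, u ∉ Γ.O → ∀ v ∈ p u, u ≠ v →
    ¬ Γ.labIn v {MeasLabel.X, MeasLabel.Y} → prec u v
  pf2 : ∀ u, u ∉ Γ.O → ∀ v ∈ odd Γ.G (p u), u ≠ v →
    ¬ Γ.labIn v {MeasLabel.Y, MeasLabel.Z} → prec u v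
  pf3 : ∀ u, u ∉ Γ.O → ∀ v, ¬ prec u v → u ≠ v →
    Γ.labIn v {MeasLabel.Y} → (v ∈ p u ↔ v ∈ odd Γ.G (p u))
  pf4 : ∀ u, u ∉ Γ.O → Γ.lam u = MeasLabel.XY → u ∉ p u ∧ u ∈ odd Γ.G (p u)
  pf5 : ∀ u, u ∉ Γ.O → Γ.lam u = MeasLabel.XZ → u ∈ p u ∧ u ∈ odd Γ.G (p u)
  pf6 : ∀ u, u ∉ Γ.O → Γ.lam u = MeasLabel.YZ → u ∈ p u ∧ u ∉ odd Γ.G (p u)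
  pf7 : ∀ u, u ∉ Γ.O → Γ.lam u = MeasLabel.X → u ∈ odd Γ.G (p u)
  pf8 : ∀ u, u ∉ Γ.O → Γ.lam u = MeasLabel.Z → u ∈ p u
  pf9 : ∀ u, u ∉ Γ.O → Γ.lam u = MeasLabel.Y →
    ((u ∈ p u ∧ u ∉ odd Γ.G (p u)) ∨ (u ∉ p u ∧ u ∈ odd Γ.G (p u)))

/-- `phat` is focussed over `S`. -/
def FocussedOver (Γ : LOG V) (phat S : Set V) : Prop :=
  (∀ w ∈ S ∩ phat, Γ.lam w ∈ ({MeasLabel.XY, MeasLabel.X, MeasLabel.Y} : Set MeasLabel)) ∧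
  (∀ w ∈ S ∩ odd Γ.G phat,
    Γ.lam w ∈ ({MeasLabel.XZ, MeasLabel.YZ, MeasLabel.Y, MeasLabel.Z} : Set MeasLabel)) ∧
  (∀ w ∈ S, Γ.lam w = MeasLabel.Y → (w ∈ phat ↔ w ∈ odd Γ.G phat))

/-- A focussed set for `Γ`: a subset of the non-inputs that is focussed over all
non-outputs. -/
def IsFocussedSet (Γ : LOG V) (phat : Set V) : Prop :=
  (∀ v ∈ phat, v ∉ Γ.I) ∧ FocussedOver Γ phat {v | v ∉ Γ.O}

/-- A Pauli flow map `p` is focussed if each `p v` is focussed over the measured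
vertices other than `v`. -/
def IsFocussed (Γ : LOG V) (p : V → Set V) : Prop :=
  ∀ v, v ∉ Γ.O → FocussedOver Γ (p v) ({w | w ∉ Γ.O} \ {v})

/-- `Vcum prec k` is `V_{∪k}^≺`, the union of the layers up to depth `k`. -/
def Vcum (prec : V → V → Prop) : ℕ → Set V
  | 0 => {v | ∀ w, ¬ prec v w}
  | k + 1 => Vcum prec k ∪ {v | v ∉ Vcum prec k ∧ ∀ w, w ∉ Vcum prec k → ¬ prec v w}

/-- `Vlayer prec k` is `V_k^≺`, the `≺`-maximal elements among the vertices not of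
smaller depth. -/
def Vlayer (prec : V → V → Prop) : ℕ → Set V
  | 0 => {v | ∀ w, ¬ prec v w}
  | k + 1 => {v | v ∉ Vcum prec k ∧ ∀ w, w ∉ Vcum prec k → ¬ prec v w}

/-- `prec` is more delayed than `prec'`. -/
def MoreDelayed (prec prec' : V → V → Prop) : Prop :=
  (∀ k, (Vcum prec' k).ncard ≤ (Vcum prec k).ncard) ∧
  ∃ k, (Vcum prec' k).ncard < (Vcum prec k).ncard

/-- A maximally delayed Pauli flow: no Pauli flow for the same labelled open graph is
more delayed. -/
def IsMaxDelayed (Γ : LOG V) (p : V → Set V) (prec : V → V → Prop) : Prop :=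
  IsPauliFlow Γ p prec ∧
  ∀ q prec', IsPauliFlow Γ q prec' → ¬ MoreDelayed prec' prec

/-- `Λ_u^P`: the measured vertices other than `u` whose label is `P`. -/
def LamP (Γ : LOG V) (u : V) (P : MeasLabel) : Set V :=
  {v | v ∉ Γ.O ∧ v ≠ u ∧ Γ.lam v = P}

/-- `V_{k+1}^{≺,XY}` where `A = V_{∪k}^≺`. -/
def VXY (Γ : LOG V) (A : Set V) : Set V :=
  {u | u ∉ Γ.O ∧ Γ.lam u ∈ ({MeasLabel.XY, MeasLabel.X, MeasLabel.Y} : Set MeasLabel) ∧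
    ∃ K, K ⊆ (A ∪ LamP Γ u MeasLabel.X ∪ LamP Γ u MeasLabel.Y) ∩ {v | v ∉ Γ.I} ∧
      (K ∩ LamP Γ u MeasLabel.Y) \ A = (odd Γ.G K ∩ LamP Γ u MeasLabel.Y) \ A ∧
      odd Γ.G K \ (A ∪ LamP Γ u MeasLabel.Y ∪ LamP Γ u MeasLabel.Z) = {u}}

/-- `V_{k+1}^{≺,XZ}` where `A = V_{∪k}^≺`. -/
def VXZ (Γ : LOG V) (A : Set V) : Set V :=
  {u | u ∉ Γ.O ∧ Γ.lam u ∈ ({MeasLabel.XZ, MeasLabel.X, MeasLabel.Z} : Set MeasLabel) ∧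
    ∃ K, K ⊆ (A ∪ LamP Γ u MeasLabel.X ∪ LamP Γ u MeasLabel.Y) ∩ {v | v ∉ Γ.I} ∧
      (K ∩ LamP Γ u MeasLabel.Y) \ A = (odd Γ.G (K ∪ {u}) ∩ LamP Γ u MeasLabel.Y) \ A ∧
      odd Γ.G (K ∪ {u}) \ (A ∪ LamP Γ u MeasLabel.Y ∪ LamP Γ u MeasLabel.Z) = {u}}

/-- `V_{k+1}^{≺,YZ}` where `A = V_{∪k}^≺`. -/
def VYZ (Γ : LOG V) (A : Set V) : Set V :=
  {u | u ∉ Γ.O ∧ Γ.lam u ∈ ({MeasLabel.YZ, MeasLabel.Y, MeasLabel.Z} : Set MeasLabel) ∧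
    ∃ K, K ⊆ (A ∪ LamP Γ u MeasLabel.X ∪ LamP Γ u MeasLabel.Y) ∩ {v | v ∉ Γ.I} ∧
      (K ∩ LamP Γ u MeasLabel.Y) \ A = (odd Γ.G (K ∪ {u}) ∩ LamP Γ u MeasLabel.Y) \ A ∧
      odd Γ.G (K ∪ {u}) \ (A ∪ LamP Γ u MeasLabel.Y ∪ LamP Γ u MeasLabel.Z) = ∅}

end LOG


/-- The graph of the input extension: a fresh vertex `none` joined only to `u`. -/
def extGraph {V : Type} (G : SimpleGraph V) (u : V) : SimpleGraph (Option V) :=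
  SimpleGraph.fromRel (fun a b =>
    (∃ a' b', a = some a' ∧ b = some b' ∧ G.Adj a' b') ∨ (a = some u ∧ b = none))

/-- The input extension of `Γ` about an input `u`: the fresh vertex `none` replaces `u`
as an input and is labelled `XY`. -/
def inputExt {V : Type} [Fintype V] (Γ : LOG V) (u : V) : LOG (Option V) where
  G := extGraph Γ.G u
  I := (Option.some '' Γ.I ∪ {(none : Option V)}) \ {some u}
  O := Option.some '' Γ.O
  lam := fun x => x.elim MeasLabel.XY Γ.lam

theorem extGraph_adj_some {V : Type} (G : SimpleGraph V) (u a b : V) :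
    (extGraph G u).Adj (some a) (some b) ↔ G.Adj a b := by
  simp only [extGraph, SimpleGraph.fromRel_adj]
  constructor
  · rintro ⟨_, (⟨a', b', ha, hb, h⟩ | ⟨_, h⟩) | (⟨a', b', ha, hb, h⟩ | ⟨_, h⟩)⟩
    · cases ha; cases hb; exact h
    · cases h
    · cases ha; cases hb; exact h.symm
    · cases h
  · intro h
    exact ⟨fun e => h.ne (Option.some.inj e), Or.inl (Or.inl ⟨a, b, rfl, rfl, h⟩)⟩

theorem extGraph_adj_none {V : Type} (G : SimpleGraph V) (u b : V) :
    (extGraph G u).Adj none (some b) ↔ b = u := by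
  simp [extGraph, SimpleGraph.fromRel_adj]

theorem odd_ext_some {V : Type} [Fintype V] (G : SimpleGraph V) (u w : V) (A : Set V) :
    some w ∈ LOG.odd (extGraph G u) (some '' A) ↔ w ∈ LOG.odd G A := by
  have e : (extGraph G u).neighborSet (some w) ∩ some '' A
      = some '' (G.neighborSet w ∩ A) := by
    ext x
    constructor
    · rintro ⟨h, a, ha, rfl⟩
      exact ⟨a, ⟨(extGraph_adj_some G u w a).1 h, ha⟩, rfl⟩
    · rintro ⟨a, ⟨h, ha⟩, rfl⟩
      exact ⟨(extGraph_adj_some G u w a).2 h, a, ha, rfl⟩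
  simp only [LOG.odd, Set.mem_setOf_eq]
  rw [e, Set.ncard_image_of_injective _ (Option.some_injective V)]

theorem odd_ext_none {V : Type} [Fintype V] (G : SimpleGraph V) (u : V) (A : Set V)
    (hA : u ∉ A) : none ∉ LOG.odd (extGraph G u) (some '' A) := by
  have e : (extGraph G u).neighborSet none ∩ some '' A = ∅ := by
    ext x
    simp only [Set.mem_empty_iff_false, iff_false]
    rintro ⟨h, a, ha, rfl⟩
    have := (extGraph_adj_none G u a).1 h
    subst this
    exact hA ha
  simp only [LOG.odd, Set.mem_setOf_eq]
  rw [e]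
  simp

theorem odd_ext_single {V : Type} [Fintype V] (G : SimpleGraph V) (u : V) :
    none ∈ LOG.odd (extGraph G u) {some u} := by
  have e : (extGraph G u).neighborSet none ∩ {some u} = {some u} := by
    apply Set.inter_eq_right.2
    rintro x rfl
    exact (extGraph_adj_none G u u).2 rfl
  simp only [LOG.odd, Set.mem_setOf_eq]
  rw [e]
  simp

/-- The correction map of the input extension. -/
def extP {V : Type} (u : V) (p : V → Set V) : Option V → Set (Option V)
  | none => {some u}
  | some v => some '' p v

/-- The order of the input extension: the fresh vertex comes first. -/
def extPrec {V : Type} (prec : V → V → Prop) : Option V → Option V → Prop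
  | none, none => False
  | none, some _ => True
  | some _, none => False
  | some a, some b => prec a b

theorem inputExt_O_some {V : Type} [Fintype V] (Γ : LOG V) (u v : V) :
    some v ∈ (inputExt Γ u).O ↔ v ∈ Γ.O := by
  simp [inputExt]

theorem inputExt_labIn_some {V : Type} [Fintype V] (Γ : LOG V) (u v : V)
    (s : Set MeasLabel) : (inputExt Γ u).labIn (some v) s ↔ Γ.labIn v s := by
  simp [inputExt, LOG.labIn]

open LOG in
/-- input extension preserves the existence of a Pauli flow. -/
theorem inputExt_hasPauliFlow {V : Type} [Fintype V] (Γ : LOG V)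
    (u : V) (hu : u ∈ Γ.I)
    (h : ∃ p prec, IsPauliFlow Γ p prec) :
    ∃ p' prec', IsPauliFlow (inputExt Γ u) p' prec' := by
  obtain ⟨p, prec, h⟩ := h
  have hup : ∀ v, v ∉ Γ.O → u ∉ p v := fun v hv hm => h.psub v hv u hm hu
  have hO : ∀ v, some v ∉ (inputExt Γ u).O → v ∉ Γ.O := fun v hv hm =>
    hv ((inputExt_O_some Γ u v).2 hm)
  have hp : ∀ v w, some w ∈ extP u p (some v) ↔ w ∈ p v := by
    intro v w
    simp [extP]
  have hodd : ∀ v w, some w ∈ odd (inputExt Γ u).G (extP u p (some v)) ↔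
      w ∈ odd Γ.G (p v) := fun v w => odd_ext_some Γ.G u w (p v)
  have hlam : ∀ v, (inputExt Γ u).lam (some v) = Γ.lam v := fun v => rfl
  refine ⟨extP u p, extPrec prec, ?_, ?_, ?_, ?_, ?_, ?_, ?_, ?_, ?_, ?_, ?_, ?_⟩
  · rintro (_ | a)
    · exact id
    · exact h.irrefl a
  · rintro (_ | a) (_ | b) (_ | c) h1 h2 <;> simp_all [extPrec]
    exact h.trans a b c h1 h2
  · rintro (_ | v) hv x hx
    · have : x = some u := hx
      subst this
      simp [inputExt]
    · obtain ⟨w, hw, rfl⟩ := hx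
      have := h.psub v (hO v hv) w hw
      simp [inputExt, this]
  · rintro (_ | v) hv (_ | w) hx hne hl
    · exact absurd rfl hne
    · trivial
    · simp [extP] at hx
    · exact h.pf1 v (hO v hv) w ((hp v w).1 hx) (fun e => hne (congrArg some e))
        (fun hh => hl ((inputExt_labIn_some Γ u w _).2 hh))
  · rintro (_ | v) hv (_ | w) hx hne hl
    · exact absurd rfl hne
    · trivial
    · exact absurd hx (odd_ext_none Γ.G u (p v) (hup v (hO v hv)))
    · exact h.pf2 v (hO v hv) w ((hodd v w).1 hx) (fun e => hne (congrArg some e))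
        (fun hh => hl ((inputExt_labIn_some Γ u w _).2 hh))
  · rintro (_ | v) hv (_ | w) hx hne hl
    · exact absurd rfl hne
    · exact absurd trivial hx
    · simp [inputExt, labIn] at hl
    · rw [hp, hodd]
      exact h.pf3 v (hO v hv) w hx (fun e => hne (congrArg some e))
        ((inputExt_labIn_some Γ u w _).1 hl)
  · rintro (_ | v) hv hl
    · exact ⟨by simp [extP], odd_ext_single Γ.G u⟩
    · rw [hp, hodd]
      exact h.pf4 v (hO v hv) hl
  · rintro (_ | v) hv hl
    · cases hl
    · rw [hp, hodd]
      exact h.pf5 v (hO v hv) hl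
  · rintro (_ | v) hv hl
    · cases hl
    · rw [hp, hodd]
      exact h.pf6 v (hO v hv) hl
  · rintro (_ | v) hv hl
    · cases hl
    · rw [hodd]
      exact h.pf7 v (hO v hv) hl
  · rintro (_ | v) hv hl
    · cases hl
    · rw [hp]
      exact h.pf8 v (hO v hv) hl
  · rintro (_ | v) hv hl
    · cases hl
    · rw [hp, hodd]
      exact h.pf9 v (hO v hv) hl
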